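/- Let f, g be holomorphic near 0 ∈ ℂ with g(0) ≠ 0, and consider the vector field X = x²∂x + (f(y)·x + g(y))·y∂y on a neighborhood of 0 ∈ ℂ². Then there exist a constant α ∈ ℂ, α ≠ 0, a local biholomorphism η of (ℂ,0) (η(0) = 0, η'(0) ≠ 0), a holomorphic function u near 0 ∈ ℂ² with u(0) ≠ 0, and a holomorphic function h near 0 ∈ ℂ with h(0) = f(0), such that the map Φ(x,y) = (α·x, η(y)) satisfies DΦ(p)·X(p) = u(p)·X_h(Φ(p)) near 0, where X_h = x²∂x + (y + x·y·h(y))∂y. -/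

import Mathlib

open Filter Topology

/-- A germ of holomorphic function of one variable has a holomorphic primitive. -/
theorem AnalyticAt.exists_primitive {k : ℂ → ℂ} {z : ℂ} (hk : AnalyticAt ℂ k z) :
    ∃ K : ℂ → ℂ, AnalyticAt ℂ K z ∧ ∀ᶠ y in 𝓝 z, HasDerivAt K (k y) y := by
  obtain ⟨r, hr, hkr⟩ := Metric.eventually_nhds_iff_ball.1 hk.eventually_analyticAt
  have hd : DifferentiableOn ℂ k (Metric.ball z r) := fun y hy =>
    (hkr y hy).differentiableAt.differentiableWithinAt
  obtain ⟨K, hK⟩ := hd.isExactOn_ball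
  have hball := Metric.ball_mem_nhds z hr
  refine ⟨K, ?_, eventually_of_mem hball hK⟩
  exact DifferentiableOn.analyticAt
    (fun y hy => (hK y hy).differentiableAt.differentiableWithinAt) hball

/-- Linearization of the one-dimensional vector field `g(y)·y∂y`: there is a local biholomorphism
`η` of `(ℂ,0)` with `η'(y)·g(y)·y = g(0)·η(y)`. -/
theorem exists_linearization {g : ℂ → ℂ} (hg : AnalyticAt ℂ g 0) (hg0 : g 0 ≠ 0) :
    ∃ η : ℂ → ℂ, AnalyticAt ℂ η 0 ∧ η 0 = 0 ∧ deriv η 0 ≠ 0 ∧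
      ∀ᶠ y in 𝓝 0, deriv η y * (g y * y) = g 0 * η y := by
  set q : ℂ → ℂ := fun y => g 0 / g y with hq
  have hqa : AnalyticAt ℂ q 0 := analyticAt_const.div hg hg0
  have hk : AnalyticAt ℂ (dslope q 0) 0 := by
    obtain ⟨p, hp⟩ := hqa
    exact hp.has_fpower_series_dslope_fslope.analyticAt
  obtain ⟨K, hKa, hK⟩ := hk.exists_primitive
  have hderiv : ∀ᶠ y in 𝓝 0, HasDerivAt (fun y => y * Complex.exp (K y))
      (Complex.exp (K y) * q y) y := by
    filter_upwards [hK, hg.continuousAt.eventually_ne hg0] with y hy hgy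
    refine ((hasDerivAt_id y).mul hy.cexp).congr_deriv ?_
    have h1 : y * dslope q 0 y = q y - 1 := by
      have := sub_smul_dslope q 0 y
      simpa [hq, hg0] using this
    simp only [id]
    linear_combination Complex.exp (K y) * h1
  refine ⟨fun y => y * Complex.exp (K y), analyticAt_id.mul hKa.cexp, by simp, ?_, ?_⟩
  · rw [hderiv.self_of_nhds.deriv]
    simp [hq, hg0]
  · filter_upwards [hderiv, hg.continuousAt.eventually_ne hg0] with y hy hgy
    rw [hy.deriv]
    simp only [hq]
    field_simp

/-- A germ of holomorphic function factors through any local biholomorphism. -/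
theorem AnalyticAt.exists_comp_eq {F η : ℂ → ℂ} {z : ℂ} (hF : AnalyticAt ℂ F z)
    (hη : AnalyticAt ℂ η z) (hη' : deriv η z ≠ 0) :
    ∃ h : ℂ → ℂ, AnalyticAt ℂ h (η z) ∧ ∀ᶠ y in 𝓝 z, h (η y) = F y := by
  have hleft := hη.hasStrictDerivAt.eventually_left_inverse hη'
  refine ⟨F ∘ hη.hasStrictDerivAt.localInverse _ _ _ hη', ?_, ?_⟩
  · refine AnalyticAt.comp ?_ (hη.analyticAt_localInverse hη')
    rwa [hleft.self_of_nhds]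
  · filter_upwards [hleft] with y hy
    simp [hy]

/-- **Lemma (final normalization, central-manifold form).** The vector field
`X = x²∂x + (f(y)·x + g(y))·y∂y` with `g 0 ≠ 0` is carried, by a map
`Φ(x,y) = (α·x, η(y))` with `α ≠ 0` and `η` a local biholomorphism of `(ℂ,0)`,
onto a nonvanishing multiple of `X_h = x²∂x + (y + x·y·h(y))∂y`, where `h` is
holomorphic near `0` with `h 0 = f 0`. -/
theorem final_normalization_central
    (f g : ℂ → ℂ) (hf : AnalyticAt ℂ f 0) (hg : AnalyticAt ℂ g 0) (hg0 : g 0 ≠ 0) :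
    ∃ (α : ℂ) (η : ℂ → ℂ) (u : ℂ × ℂ → ℂ) (h : ℂ → ℂ),
      α ≠ 0 ∧ AnalyticAt ℂ η 0 ∧ η 0 = 0 ∧ deriv η 0 ≠ 0 ∧
      AnalyticAt ℂ u 0 ∧ u 0 ≠ 0 ∧ AnalyticAt ℂ h 0 ∧ h 0 = f 0 ∧
      ∀ᶠ p in nhds (0 : ℂ × ℂ),
        fderiv ℂ (fun q : ℂ × ℂ => (α * q.1, η q.2)) p
            (p.1 ^ 2, (f p.2 * p.1 + g p.2) * p.2)
          = u p • (((α * p.1) ^ 2, η p.2 + (α * p.1) * (η p.2 * h (η p.2))) : ℂ × ℂ) := by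
  obtain ⟨η, hη, hη0, hη', hlin⟩ := exists_linearization hg hg0
  have hF : AnalyticAt ℂ (fun y => f y * g 0 / g y) 0 := (hf.mul analyticAt_const).div hg hg0
  obtain ⟨h, hh, hcomp⟩ := hF.exists_comp_eq hη hη'
  rw [hη0] at hh
  refine ⟨(g 0)⁻¹, η, fun _ => g 0, h, inv_ne_zero hg0, hη, hη0, hη', analyticAt_const, hg0, hh,
    ?_, ?_⟩
  · have := hcomp.self_of_nhds
    rwa [hη0, mul_div_cancel_right₀ _ hg0] at this
  have hsnd : Tendsto Prod.snd (𝓝 (0 : ℂ × ℂ)) (𝓝 (0 : ℂ)) := continuous_snd.tendsto 0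
  filter_upwards [hsnd.eventually hlin, hsnd.eventually hcomp,
    hsnd.eventually hη.eventually_analyticAt,
    hsnd.eventually (hg.continuousAt.eventually_ne hg0)] with p hlin hcomp hηp hgp
  have hfst : HasFDerivAt (fun q : ℂ × ℂ => (g 0)⁻¹ * q.1)
      ((g 0)⁻¹ • ContinuousLinearMap.fst ℂ ℂ ℂ) p := hasFDerivAt_fst.const_mul _
  have hsnd' : HasFDerivAt (fun q : ℂ × ℂ => η q.2)
      (deriv η p.2 • ContinuousLinearMap.snd ℂ ℂ ℂ) p :=
    hηp.differentiableAt.hasDerivAt.comp_hasFDerivAt p hasFDerivAt_snd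
  rw [(hfst.prodMk hsnd').fderiv, hcomp]
  ext
  · simp
    field_simp
  · simp
    field_simp
    linear_combination (f p.2 * p.1 + g p.2) * hlin
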